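/- arXiv:2202.08903 — 2 statements merged into one kernel-verified Lean document; each statement's English description precedes it below -/
import Mathlib

section
/- Let μ be an allocation reachable by the greedy process, let B = Σ_k μ_k be its total, and let μ* be any B-minimal allocation. Then the ℓ∞ distance between μ and μ* is at most 1, i.e., |μ_k − μ*_k| ≤ 1 for every index k ∈ {1, …, h}. -/
open Finset

/-- Computational delay of a VM with load parameter `a` and work parameter `c`
under a CPU allocation of `μ` units: `D(μ) = c / (μ - a)`. -/
noncomputable def Dd (a c : ℝ) (μ : ℕ) : ℝ := c / ((μ : ℝ) - a)

/-- Delay-reduction function `δ(μ) = D(μ) - D(μ+1)`. -/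
noncomputable def deltad (a c : ℝ) (μ : ℕ) : ℝ := Dd a c μ - Dd a c (μ + 1)

/-- An allocation is a vector `μ : Fin h → ℕ` with `μ k > a k` for every `k`. -/
def IsAlloc {h : ℕ} (a : Fin h → ℝ) (μ : Fin h → ℕ) : Prop := ∀ k, a k < (μ k : ℝ)

/-- The (total computational) delay of an allocation: `Σ_k D_k(μ_k)`. -/
noncomputable def delay {h : ℕ} (a c : Fin h → ℝ) (μ : Fin h → ℕ) : ℝ :=
  ∑ k, Dd (a k) (c k) (μ k)

/-- `μ*` is `B`-minimal if its total equals `B` and its delay is less than or equal to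
the delay of every allocation whose total equals `B`. -/
def BMinimal {h : ℕ} (a c : Fin h → ℝ) (B : ℕ) (μstar : Fin h → ℕ) : Prop :=
  IsAlloc a μstar ∧ (∑ k, μstar k) = B ∧
    ∀ ν : Fin h → ℕ, IsAlloc a ν → (∑ k, ν k) = B → delay a c μstar ≤ delay a c ν

/-- The initial allocation of the greedy process: `μ⁰_k = ⌊a_k⌋ + 1`. -/
noncomputable def initAlloc {h : ℕ} (a : Fin h → ℝ) : Fin h → ℕ := fun k => ⌊a k⌋₊ + 1

/-- A greedy step from `μ` to `μ'` chooses an index `k*` maximizing the delay reduction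
`δ_k(μ_k)` and increments the allocation of `k*` by one CPU unit. -/
def GreedyStep {h : ℕ} (a c : Fin h → ℝ) (μ μ' : Fin h → ℕ) : Prop :=
  ∃ kstar : Fin h,
    (∀ k, deltad (a k) (c k) (μ k) ≤ deltad (a kstar) (c kstar) (μ kstar)) ∧
    μ' = Function.update μ kstar (μ kstar + 1)

/-- An allocation is reachable if it is obtained from the initial allocation `μ⁰`
by a finite sequence of greedy steps. -/
def Reachable {h : ℕ} (a c : Fin h → ℝ) (μ : Fin h → ℕ) : Prop :=
  Relation.ReflTransGen (GreedyStep a c) (initAlloc a) μ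

theorem deltad_eq {a : ℝ} (c : ℝ) {m : ℕ} (hm : a < m) :
    deltad a c m = c / (((m : ℝ) - a) * ((m : ℝ) + 1 - a)) := by
  have h₁ : (m : ℝ) - a ≠ 0 := by linarith
  have h₂ : (m : ℝ) + 1 - a ≠ 0 := by linarith
  unfold deltad Dd
  push_cast
  field_simp
  ring

theorem deltad_lt_deltad {a c : ℝ} (hc : 0 < c) {m n : ℕ} (hm : a < m) (hmn : m < n) :
    deltad a c n < deltad a c m := by
  have hmn' : (m : ℝ) < n := by exact_mod_cast hmn
  rw [deltad_eq c hm, deltad_eq c (hm.trans hmn')]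
  have h₁ : 0 < (m : ℝ) - a := by linarith
  have h₂ : 0 < (m : ℝ) + 1 - a := by linarith
  gcongr

theorem deltad_le_deltad {a c : ℝ} (hc : 0 < c) {m n : ℕ} (hm : a < m) (hmn : m ≤ n) :
    deltad a c n ≤ deltad a c m := by
  rcases hmn.eq_or_lt with rfl | hlt
  · exact le_rfl
  · exact (deltad_lt_deltad hc hm hlt).le

/-- Along the greedy process no available reduction exceeds a reduction already made. -/
theorem Reachable.initAlloc_le_and_deltad_le {h : ℕ} {a c : Fin h → ℝ} (hc : ∀ k, 0 < c k)
    {μ : Fin h → ℕ} (hμ : Reachable a c μ) :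
    (∀ k, initAlloc a k ≤ μ k) ∧ ∀ i k m, initAlloc a k ≤ m → m < μ k →
      deltad (a i) (c i) (μ i) ≤ deltad (a k) (c k) m := by
  induction hμ with
  | refl => exact ⟨fun _ => le_rfl, fun _ _ _ h₁ h₂ => absurd h₂ h₁.not_gt⟩
  | @tail ν ν' _ hstep ih =>
    obtain ⟨j, hj, rfl⟩ := hstep
    obtain ⟨hle, hδ⟩ := ih
    have hmono : ∀ i, ν i ≤ Function.update ν j (ν j + 1) i := by
      intro i
      rcases eq_or_ne i j with rfl | hij <;> simp [*]
    refine ⟨fun k => (hle k).trans (hmono k), fun i k m hm hmk => ?_⟩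
    have ha : a i < ν i := (Nat.lt_floor_add_one (a i)).trans_le (by exact_mod_cast hle i)
    refine (deltad_le_deltad (hc i) ha (hmono i)).trans ?_
    rcases eq_or_ne k j with rfl | hkj
    · rw [Function.update_self] at hmk
      rcases (Nat.lt_succ_iff.mp hmk).eq_or_lt with rfl | hlt
      · exact hj i
      · exact hδ i k m hm hlt
    · rw [Function.update_of_ne hkj] at hmk
      exact hδ i k m hm hmk

theorem sum_update_update {ι M : Type*} [Fintype ι] [DecidableEq ι] [AddCommMonoid M]
    (g : ι → ℕ → M) (ν : ι → ℕ) {i j : ι} (hij : i ≠ j) (x y : ℕ) :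
    ∑ k, g k (Function.update (Function.update ν j y) i x k) + (g i (ν i) + g j (ν j)) =
      ∑ k, g k (ν k) + (g i x + g j y) := by
  have hj : j ∈ (univ.erase i : Finset ι) := by simp [hij.symm]
  have hrest : ∑ k ∈ (univ.erase i).erase j,
      g k (Function.update (Function.update ν j y) i x k) =
      ∑ k ∈ (univ.erase i).erase j, g k (ν k) := by
    refine sum_congr rfl fun k hk => ?_
    simp only [mem_erase] at hk
    rw [Function.update_of_ne hk.2.1, Function.update_of_ne hk.1]
  rw [← add_sum_erase univ _ (mem_univ i), ← add_sum_erase _ _ hj, hrest,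
    ← add_sum_erase univ (fun k => g k (ν k)) (mem_univ i), ← add_sum_erase _ _ hj,
    Function.update_self, Function.update_of_ne hij.symm, Function.update_self]
  abel

/-- Moving a CPU unit from `j` to `i` does not improve a minimal allocation. -/
theorem BMinimal.deltad_le {h : ℕ} {a c : Fin h → ℝ} {B : ℕ} {ν : Fin h → ℕ}
    (hν : BMinimal a c B ν) {i j : Fin h} (hij : i ≠ j) {m : ℕ} (hm : a j < m)
    (hj : ν j = m + 1) :
    deltad (a i) (c i) (ν i) ≤ deltad (a j) (c j) m := by
  obtain ⟨halloc, hsum, hopt⟩ := hν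
  have htotal := sum_update_update (fun _ n => n) ν hij (ν i + 1) m
  have hdelay := sum_update_update (fun k n => Dd (a k) (c k) n) ν hij (ν i + 1) m
  have hle := hopt (Function.update (Function.update ν j m) i (ν i + 1)) ?_ (by omega)
  · simp only [hj] at hdelay
    unfold delay at hle
    unfold deltad
    linarith
  · intro k
    rcases eq_or_ne k i with rfl | hki
    · rw [Function.update_self]
      push_cast
      linarith [halloc k]
    · rw [Function.update_of_ne hki]
      rcases eq_or_ne k j with rfl | hkj
      · rwa [Function.update_self]
      · rw [Function.update_of_ne hkj]
        exact halloc k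

theorem exists_lt_of_sum_eq {ι : Type*} [Fintype ι] {f g : ι → ℕ}
    (hsum : ∑ k, f k = ∑ k, g k) {i : ι} (hi : g i < f i) : ∃ j, f j < g j := by
  by_contra! hle
  exact (sum_lt_sum (fun k _ => hle k) ⟨i, mem_univ i, hi⟩).ne' hsum

/-- Let `μ` be an allocation reachable by the greedy process, let
`B = Σ_k μ_k` be its total, and let `μ*` be any `B`-minimal allocation. Then the ℓ∞
distance between `μ` and `μ*` is at most 1: `|μ_k − μ*_k| ≤ 1` for every index `k`. -/
theorem greedy_linf_dist_le_one {h : ℕ} (hh : 1 ≤ h) (a c : Fin h → ℝ)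
    (ha : ∀ k, 0 ≤ a k) (hc : ∀ k, 0 < c k)
    (μ : Fin h → ℕ) (hμ : Reachable a c μ)
    (μstar : Fin h → ℕ) (hmin : BMinimal a c (∑ k, μ k) μstar) :
    ∀ k, |(μ k : ℤ) - (μstar k : ℤ)| ≤ 1 := by
  obtain ⟨hle, hδ⟩ := hμ.initAlloc_le_and_deltad_le hc
  have hsum : ∑ k, μstar k = ∑ k, μ k := hmin.2.1
  have hlt : ∀ k, a k < (initAlloc a k : ℝ) := fun k => by
    simpa [initAlloc] using Nat.lt_floor_add_one (a k)
  have hstar : ∀ k, initAlloc a k ≤ μstar k := fun k =>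
    (Nat.floor_lt (ha k)).mpr (hmin.1 k)
  have hlt_of_le : ∀ {k m}, initAlloc a k ≤ m → a k < (m : ℝ) := fun {k m} hm =>
    (hlt k).trans_le (by exact_mod_cast hm)
  intro k
  by_contra hk
  have hcases : μstar k + 2 ≤ μ k ∨ μ k + 2 ≤ μstar k := by
    rw [abs_le] at hk
    omega
  rcases hcases with hgt | hgt
  · obtain ⟨j, hj⟩ := exists_lt_of_sum_eq hsum.symm (i := k) (by omega)
    have hkj : k ≠ j := by rintro rfl; omega
    obtain ⟨m, hm⟩ : ∃ m, μstar j = m + 1 := ⟨μstar j - 1, by omega⟩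
    have hjm : μ j ≤ m := by omega
    have h₁ := hmin.deltad_le hkj (hlt_of_le ((hle j).trans hjm)) hm
    have h₂ := deltad_le_deltad (hc j) (hlt_of_le (hle j)) hjm
    have h₃ := hδ j k (μstar k + 1) ((hstar k).trans (Nat.le_succ _)) (by omega)
    have h₄ := deltad_lt_deltad (hc k) (hmin.1 k) (Nat.lt_succ_self _)
    exact (h₁.trans (h₂.trans h₃)).not_gt h₄
  · obtain ⟨j, hj⟩ := exists_lt_of_sum_eq hsum (i := k) (by omega)
    have hjk : j ≠ k := by rintro rfl; omega
    obtain ⟨m, hm⟩ : ∃ m, μstar k = m + 1 := ⟨μstar k - 1, by omega⟩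
    have hkm : μ k < m := by omega
    have h₁ := hmin.deltad_le hjk (hlt_of_le ((hle k).trans hkm.le)) hm
    have h₂ := deltad_lt_deltad (hc k) (hlt_of_le (hle k)) hkm
    have h₃ := hδ k j (μstar j) (hstar j) hj
    exact (h₃.trans h₁).not_gt h₂
end

section
/- Every allocation μ reachable by the greedy process is B-minimal for B = Σ_k μ_k: its delay Σ_k D_k(μ_k) is less than or equal to the delay of every allocation whose total equals B. -/
open Finset

lemma Dd_sub_Dd_le {a c : ℝ} (hc : 0 ≤ c) {m n : ℕ} (hm : a < m) (hn : a < n) :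
    Dd a c m - Dd a c n ≤ deltad a c m * ((n : ℝ) - m) := by
  have hx : 0 < (m : ℝ) - a := sub_pos.2 hm
  have hy : 0 < (n : ℝ) - a := sub_pos.2 hn
  have hx' : 0 < (m : ℝ) + 1 - a := by linarith
  have hd : 0 ≤ ((n : ℝ) - m) * ((n : ℝ) - m - 1) := by
    rcases le_or_gt n m with h | h
    · have h' : (n : ℝ) ≤ m := by exact_mod_cast h
      exact mul_nonneg_of_nonpos_of_nonpos (by linarith) (by linarith)
    · have h' : (m : ℝ) + 1 ≤ n := by exact_mod_cast h
      exact mul_nonneg (by linarith) (by linarith)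
  have key : deltad a c m * ((n : ℝ) - m) - (Dd a c m - Dd a c n) =
      c * (((n : ℝ) - m) * ((n : ℝ) - m - 1)) /
        (((m : ℝ) - a) * ((m : ℝ) + 1 - a) * ((n : ℝ) - a)) := by
    unfold deltad Dd
    push_cast
    field_simp
    ring
  refine sub_nonneg.1 (key ▸ ?_)
  positivity

lemma deltad_succ_le {a c : ℝ} (hc : 0 ≤ c) {m : ℕ} (hm : a < m) :
    deltad a c (m + 1) ≤ deltad a c m := by
  have h := Dd_sub_Dd_le hc hm (n := m + 1 + 1) (by push_cast; linarith)
  push_cast at h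
  unfold deltad at *
  linarith

lemma Reachable.isAlloc {h : ℕ} {a c : Fin h → ℝ} {μ : Fin h → ℕ} (hμ : Reachable a c μ) :
    IsAlloc a μ := by
  induction hμ with
  | refl =>
    intro k
    simpa [initAlloc] using Nat.lt_floor_add_one (a k)
  | tail _ hstep ih =>
    obtain ⟨i, -, rfl⟩ := hstep
    intro k
    rcases eq_or_ne k i with rfl | hk
    · have := ih k
      rw [Function.update_self]
      push_cast
      linarith
    · simpa [hk] using ih k

lemma Reachable.deltad_le {h : ℕ} {a c : Fin h → ℝ} (ha : ∀ k, 0 ≤ a k) (hc : ∀ k, 0 < c k)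
    {μ : Fin h → ℕ} (hμ : Reachable a c μ) {j : Fin h} {m : ℕ} (hj : μ j = m + 1)
    (hm : a j < m) (k : Fin h) :
    deltad (a k) (c k) (μ k) ≤ deltad (a j) (c j) m := by
  induction hμ generalizing k with
  | refl =>
    have hfloor : ⌊a j⌋₊ = m := by simpa [initAlloc] using hj
    have := Nat.floor_le (ha j)
    rw [hfloor] at this
    linarith
  | @tail ν _ hν hstep ih =>
    obtain ⟨i, hi, rfl⟩ := hstep
    have hle : deltad (a k) (c k) (Function.update ν i (ν i + 1) k) ≤
        deltad (a k) (c k) (ν k) := by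
      rcases eq_or_ne k i with rfl | hk
      · rw [Function.update_self]
        exact deltad_succ_le (hc k).le (Reachable.isAlloc hν k)
      · rw [Function.update_of_ne hk]
    refine hle.trans ?_
    rcases eq_or_ne j i with rfl | hji
    · have : ν j = m := by simpa using hj
      exact this ▸ hi k
    · exact ih (by simpa [hji] using hj) k

/-- Every allocation `μ` reachable by the greedy process is `B`-minimal for
`B = Σ_k μ_k`: its delay is less than or equal to the delay of every allocation whose
total equals `B`. -/
theorem greedy_is_bminimal {h : ℕ} (hh : 1 ≤ h) (a c : Fin h → ℝ)
    (ha : ∀ k, 0 ≤ a k) (hc : ∀ k, 0 < c k)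
    (μ : Fin h → ℕ) (hμ : Reachable a c μ) :
    ∀ ν : Fin h → ℕ, IsAlloc a ν → (∑ k, ν k) = (∑ k, μ k) →
      delay a c μ ≤ delay a c ν := by
  intro ν hν hsum
  have : Nonempty (Fin h) := ⟨⟨0, hh⟩⟩
  obtain ⟨i, hi⟩ := Finite.exists_max fun k => deltad (a k) (c k) (μ k)
  set t := deltad (a i) (c i) (μ i)
  have hterm : ∀ k, Dd (a k) (c k) (μ k) - Dd (a k) (c k) (ν k) ≤ t * ((ν k : ℝ) - μ k) := by
    intro k
    rcases le_or_gt (μ k) (ν k) with hle | hlt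
    · refine (Dd_sub_Dd_le (hc k).le (hμ.isAlloc k) (hν k)).trans ?_
      exact mul_le_mul_of_nonneg_right (hi k) (sub_nonneg.2 (by exact_mod_cast hle))
    · obtain ⟨m, hm⟩ := Nat.exists_eq_succ_of_ne_zero (Nat.ne_zero_of_lt hlt)
      have hνm : (ν k : ℝ) ≤ m := by exact_mod_cast (by omega : ν k ≤ m)
      have ham : a k < m := (hν k).trans_le hνm
      have ht : t ≤ deltad (a k) (c k) m := hμ.deltad_le ha hc hm ham i
      have htangent := Dd_sub_Dd_le (hc k).le ham (hν k)
      have hdelta : deltad (a k) (c k) m = Dd (a k) (c k) m - Dd (a k) (c k) (m + 1) := rfl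
      rw [hm, Nat.succ_eq_add_one]
      push_cast
      nlinarith
  have hcast : (∑ k, (ν k : ℝ)) = ∑ k, (μ k : ℝ) := by exact_mod_cast hsum
  have htotal := Finset.sum_le_sum fun k (_ : k ∈ Finset.univ) => hterm k
  rw [← Finset.mul_sum, Finset.sum_sub_distrib, Finset.sum_sub_distrib, hcast, sub_self,
    mul_zero] at htotal
  exact sub_nonpos.1 htotal
end
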